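/- Let j ≥ 5 be odd, a = φ_{j−2}², b = φ_j², d = φ_{j−2}·φ_j = φ_{j−1}² + 1, and Γ = ⟨a,b⟩. Then for every l ≥ 0, the number of elements of Γ in ((l−1)d, ld] equals min{l+1, d}. -/

import Mathlib

namespace FibStrip

/-- Integer points of the dilated triangle in mutation coordinates. -/
def T (p q l : ℤ) : Set (ℤ × ℤ × ℤ) :=
  {x | 0 ≤ x.1 ∧ 0 ≤ x.1 + p * x.2.1 ∧ 0 ≤ x.1 + q * x.2.2 ∧
    3 * x.1 + p * x.2.2 + q * x.2.1 = l}

/-- Lattice points `(i, m)` of value at most `l p q`. -/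
def A (p q l : ℤ) : Set (ℕ × ℕ) :=
  {x | (x.1 : ℤ) * p ^ 2 + (x.2 : ℤ) * q ^ 2 ≤ l * (p * q)}

lemma base_card (n : ℕ) : 2 * (T 1 1 ((n : ℤ) - 1)).ncard = n * (n + 1) := by
  have h1 : ((Finset.range n).sigma (fun k => Finset.range (k + 1))).card * 2 = n * (n + 1) := by
    rw [Finset.card_sigma]
    simp only [Finset.card_range]
    induction n with
    | zero => simp
    | succ k ih => rw [Finset.sum_range_succ, add_mul, ih]; ring
  have h2 : (T 1 1 ((n : ℤ) - 1)).ncard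
      = ((Finset.range n).sigma (fun k => Finset.range (k + 1))).card := by
    rw [← Set.ncard_coe_finset]
    symm
    refine Set.ncard_congr (fun s _ => ((n : ℤ) - 1 - s.1,
      ((s.1 : ℤ) - s.2) - ((n : ℤ) - 1 - s.1), (s.2 : ℤ) - ((n : ℤ) - 1 - s.1))) ?_ ?_ ?_
    · rintro ⟨k, i⟩ h
      simp only [Finset.coe_sigma, Set.mem_sigma_iff, Finset.coe_range, Set.mem_Iio] at h
      simp only [T, Set.mem_ofPred_eq]
      omega
    · rintro ⟨k, i⟩ ⟨k', i'⟩ _ _ h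
      simp only [Prod.mk.injEq] at h
      obtain ⟨h1, h2, h3⟩ := h
      have e1 : k = k' := by omega
      have e2 : i = i' := by omega
      subst e1; subst e2; rfl
    · rintro ⟨r, u, v⟩ h
      simp only [T, Set.mem_ofPred_eq] at h
      refine ⟨⟨((n : ℤ) - 1 - r).toNat, (r + v).toNat⟩, ?_, ?_⟩
      · simp only [Finset.coe_sigma, Set.mem_sigma_iff, Finset.coe_range, Set.mem_Iio]
        omega
      · simp only [Prod.mk.injEq]
        omega
  rw [h2]; omega

/-- The mutation step. -/
lemma step_card (p p' l : ℤ) (hp' : 0 ≤ p') (hq : 0 ≤ 3 * p - p') :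
    (T p (3 * p - p') l).ncard = (T p' p l).ncard := by
  refine Set.ncard_congr (fun x _ => if 0 ≤ x.2.2
    then (x.1 + p * x.2.1, x.2.2, - x.2.1)
    else (x.1 + p * x.2.1 - p' * x.2.2, x.2.2, - (x.2.1 - 3 * x.2.2))) ?_ ?_ ?_
  · rintro ⟨r, u, v⟩ h
    simp only [T, Set.mem_ofPred_eq] at h
    obtain ⟨h1, h2, h3, h4⟩ := h
    simp only [T]
    split_ifs with hv
    · simp only [Set.mem_ofPred_eq]
      refine ⟨h2, ?_, ?_, ?_⟩
      · positivity
      · linarith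
      · linarith
    · have hv' : 0 ≤ -v := by omega
      have := mul_nonneg hp' hv'
      simp only [Set.mem_ofPred_eq]
      refine ⟨?_, ?_, ?_, ?_⟩ <;> linarith
  · rintro ⟨r, u, v⟩ ⟨r', u', v'⟩ _ _ h
    simp only at h
    split_ifs at h with a b b
    all_goals simp only [Prod.mk.injEq] at h
    all_goals obtain ⟨e1, e2, e3⟩ := h
    · subst e2
      have : u = u' := by omega
      subst this
      have : r = r' := by omega
      subst this; rfl
    · omega
    · omega
    · subst e2
      have : u = u' := by omega
      subst this
      have : r = r' := by omega
      subst this; rfl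
  · rintro ⟨R, U, V⟩ h
    simp only [T, Set.mem_ofPred_eq] at h
    obtain ⟨h1, h2, h3, h4⟩ := h
    by_cases hU : 0 ≤ U
    · refine ⟨(R + p * V, -V, U), ?_, ?_⟩
      · have := mul_nonneg hq hU
        simp only [T, Set.mem_ofPred_eq]
        refine ⟨?_, ?_, ?_, ?_⟩ <;> linarith
      · simp only [hU, if_true, Prod.mk.injEq]
        refine ⟨?_, ?_, ?_⟩ <;> first | trivial | ring
    · have hU' : 0 ≤ -U := by omega
      refine ⟨(R + p' * U - p * (3 * U - V), 3 * U - V, U), ?_, ?_⟩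
      · have := mul_nonneg hq hU'
        simp only [T, Set.mem_ofPred_eq]
        refine ⟨?_, ?_, ?_, ?_⟩ <;> linarith
      · simp only [hU, if_false, Prod.mk.injEq]
        refine ⟨?_, ?_, ?_⟩ <;> first | trivial | ring

lemma fib_T_card (k n : ℕ) :
    2 * (T (Nat.fib (2 * k + 1)) (Nat.fib (2 * k + 3)) ((n : ℤ) - 1)).ncard = n * (n + 1) := by
  induction k with
  | zero =>
    have h := step_card 1 1 ((n : ℤ) - 1) (by norm_num) (by norm_num)
    have h2 := base_card n
    rw [← h] at h2
    simpa [Nat.fib] using h2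
  | succ k ih =>
    have e0 : Nat.fib (2 * k + 3) = Nat.fib (2 * k + 1) + Nat.fib (2 * k + 2) := Nat.fib_add_two
    have e1 : Nat.fib (2 * k + 4) = Nat.fib (2 * k + 2) + Nat.fib (2 * k + 3) := Nat.fib_add_two
    have e2 : Nat.fib (2 * k + 5) = Nat.fib (2 * k + 3) + Nat.fib (2 * k + 4) := Nat.fib_add_two
    have e : (Nat.fib (2 * k + 5) : ℤ) = 3 * Nat.fib (2 * k + 3) - Nat.fib (2 * k + 1) := by omega
    rw [show 2 * (k + 1) + 1 = 2 * k + 3 by ring, show 2 * (k + 1) + 3 = 2 * k + 5 by ring, e,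
      step_card _ _ _ (by positivity) (by omega), ih]

lemma fib_markov (k : ℕ) : Nat.fib (2 * k + 1) ^ 2 + Nat.fib (2 * k + 3) ^ 2 + 1
    = 3 * (Nat.fib (2 * k + 1) * Nat.fib (2 * k + 3)) := by
  induction k with
  | zero => simp [Nat.fib]
  | succ k ih =>
    have e0 : Nat.fib (2 * k + 3) = Nat.fib (2 * k + 1) + Nat.fib (2 * k + 2) := Nat.fib_add_two
    have e1 : Nat.fib (2 * k + 4) = Nat.fib (2 * k + 2) + Nat.fib (2 * k + 3) := Nat.fib_add_two
    have e2 : Nat.fib (2 * k + 5) = Nat.fib (2 * k + 3) + Nat.fib (2 * k + 4) := Nat.fib_add_two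
    rw [show 2 * (k + 1) + 1 = 2 * k + 3 by ring, show 2 * (k + 1) + 3 = 2 * k + 5 by ring]
    rw [e2, e1]
    rw [e0] at ih ⊢
    zify at ih ⊢
    linarith

lemma A_card (p q l : ℤ) (hp : 0 < p) (hq : 0 < q) (h : p ^ 2 + q ^ 2 + 1 = 3 * (p * q)) :
    (T p q l).ncard = (A p q l).ncard := by
  have key : ∀ r u v : ℤ, 3 * r + p * v + q * u = l →
      r = l * (p * q) - (r + q * v) * p ^ 2 - (r + p * u) * q ^ 2 := by
    intro r u v e
    subst e
    linear_combination r * h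
  refine Set.ncard_congr (fun x _ => ((x.1 + q * x.2.2).toNat, (x.1 + p * x.2.1).toNat)) ?_ ?_ ?_
  · rintro ⟨r, u, v⟩ ⟨h1, h2, h3, h4⟩
    simp only at h1 h2 h3 h4
    simp only [A, Set.mem_ofPred_eq]
    rw [Int.toNat_of_nonneg h2, Int.toNat_of_nonneg h3]
    linarith [key r u v h4]
  · rintro ⟨r, u, v⟩ ⟨r', u', v'⟩ ⟨h1, h2, h3, h4⟩ ⟨h1', h2', h3', h4'⟩ e
    simp only at h1 h2 h3 h4 h1' h2' h3' h4'
    simp only [Prod.mk.injEq] at e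
    have e1 : r + q * v = r' + q * v' := by omega
    have e2 : r + p * u = r' + p * u' := by omega
    have er : r = r' := by rw [key r u v h4, key r' u' v' h4', e1, e2]
    subst er
    have ev : v = v' := mul_left_cancel₀ hq.ne' (by linarith)
    have eu : u = u' := mul_left_cancel₀ hp.ne' (by linarith)
    subst ev; subst eu; rfl
  · rintro ⟨i, m⟩ hx
    simp only [A, Set.mem_ofPred_eq] at hx
    have E1 : l * (p * q) - i * p ^ 2 - m * q ^ 2 + q * (i * (3 * p - q) + m * q - l * p) = i := by
      linear_combination -(i : ℤ) * h
    have E2 : l * (p * q) - i * p ^ 2 - m * q ^ 2 + p * (m * (3 * q - p) + i * p - l * q) = m := by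
      linear_combination -(m : ℤ) * h
    refine ⟨(l * (p * q) - i * p ^ 2 - m * q ^ 2, m * (3 * q - p) + i * p - l * q,
      i * (3 * p - q) + m * q - l * p), ⟨?_, ?_, ?_, ?_⟩, ?_⟩
    · simp only; linarith
    · simp only; rw [E2]; positivity
    · simp only; rw [E1]; positivity
    · simp only
      linear_combination -l * h
    · simp only [E1, E2, Int.toNat_natCast]

/-- The strip `((l-1)d, ld]` of lattice points. -/
def B (p q l : ℤ) : Set (ℕ × ℕ) := A p q l \ A p q (l - 1)

lemma B_card (p q : ℤ) (hp : 0 < p) (hq : 0 < q) (h : p ^ 2 + q ^ 2 + 1 = 3 * (p * q))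
    (hT : ∀ n : ℕ, 2 * (T p q ((n : ℤ) - 1)).ncard = n * (n + 1)) (l : ℕ) :
    (B p q l).Finite ∧ (B p q l).ncard = l + 1 := by
  have h1 := hT (l + 1)
  have h0 := hT l
  rw [A_card p q _ hp hq h] at h0 h1
  rw [show ((l + 1 : ℕ) : ℤ) - 1 = l by push_cast; ring] at h1
  have hf : (A p q l).Finite := by
    apply Set.finite_of_ncard_pos
    have : 0 < (l + 1) * (l + 1 + 1) := by positivity
    omega
  have hsub : A p q ((l : ℤ) - 1) ⊆ A p q l := by
    intro x hx
    simp only [A, Set.mem_ofPred_eq] at hx ⊢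
    have := mul_pos hp hq
    linarith
  refine ⟨hf.subset Set.sdiff_subset, ?_⟩
  have := Set.ncard_sdiff_add_ncard_of_subset hsub hf
  unfold B
  have e : (l + 1) * (l + 1 + 1) = l * (l + 1) + 2 * (l + 1) := by ring
  omega

lemma mem_B (p q l : ℕ) (x : ℕ × ℕ) : x ∈ B p q l ↔
    ((l : ℤ) - 1) * (p * q) < ((x.1 * p ^ 2 + x.2 * q ^ 2 : ℕ) : ℤ) ∧
      ((x.1 * p ^ 2 + x.2 * q ^ 2 : ℕ) : ℤ) ≤ (l : ℤ) * (p * q) := by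
  simp only [B, A, Set.mem_sdiff, Set.mem_ofPred_eq, not_le]
  push_cast
  tauto

lemma main (p q : ℕ) (hp : 0 < p) (hq : 0 < q) (h : p ^ 2 + q ^ 2 + 1 = 3 * (p * q))
    (hT : ∀ n : ℕ, 2 * (T p q ((n : ℤ) - 1)).ncard = n * (n + 1)) (l : ℕ) :
    Set.ncard {k : ℕ | (∃ i m : ℕ, k = i * p ^ 2 + m * q ^ 2) ∧
      ((l : ℤ) - 1) * (p * q) < (k : ℤ) ∧ (k : ℤ) ≤ (l : ℤ) * (p * q)} =
      min (l + 1) (p * q) := by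
  have hB := B_card p q (by exact_mod_cast hp) (by exact_mod_cast hq) (by exact_mod_cast h) hT
  have hco : Nat.Coprime (p ^ 2) (q ^ 2) := by
    apply Nat.Coprime.pow
    have d1 := Nat.gcd_dvd_left p q
    have d2 := Nat.gcd_dvd_right p q
    have d3 : Nat.gcd p q ∣ p ^ 2 + q ^ 2 + 1 := by
      rw [h]; exact Dvd.dvd.mul_left (Dvd.dvd.mul_right d1 _) _
    have d4 : Nat.gcd p q ∣ p ^ 2 + q ^ 2 :=
      dvd_add (dvd_pow d1 two_ne_zero) (dvd_pow d2 two_ne_zero)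
    exact Nat.dvd_one.mp ((Nat.dvd_add_right d4).mp d3)
  have hpp : 0 < p ^ 2 := by positivity
  have hqq : 0 < q ^ 2 := by positivity
  -- points with small second coordinate
  have c1 : (B p q l ∩ {x | x.2 < p ^ 2}).ncard =
      Set.ncard {k : ℕ | (∃ i m : ℕ, k = i * p ^ 2 + m * q ^ 2) ∧
      ((l : ℤ) - 1) * (p * q) < (k : ℤ) ∧ (k : ℤ) ≤ (l : ℤ) * (p * q)} := by
    refine Set.ncard_congr (fun x _ => x.1 * p ^ 2 + x.2 * q ^ 2) ?_ ?_ ?_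
    · rintro x ⟨hx, _⟩
      exact ⟨⟨x.1, x.2, rfl⟩, (mem_B p q l x).mp hx⟩
    · rintro ⟨i, m⟩ ⟨i', m'⟩ ⟨_, hm⟩ ⟨_, hm'⟩ e
      simp only [Set.mem_ofPred_eq] at hm hm' e
      have e2 : m ≡ m' [MOD p ^ 2] := by
        have : m * q ^ 2 ≡ m' * q ^ 2 [MOD p ^ 2] := by
          have e3 := congrArg (· % p ^ 2) e
          simpa [Nat.ModEq, Nat.add_mod] using e3
        exact Nat.ModEq.cancel_right_of_coprime hco this
      have e3 : m = m' := Nat.ModEq.eq_of_lt_of_lt e2 hm hm'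
      subst e3
      have : i = i' := Nat.eq_of_mul_eq_mul_right hpp (by omega)
      subst this; rfl
    · rintro k ⟨⟨i, m, rfl⟩, hk⟩
      have e : (i + (m / p ^ 2) * q ^ 2) * p ^ 2 + (m % p ^ 2) * q ^ 2
          = i * p ^ 2 + m * q ^ 2 := by
        conv_rhs => rw [← Nat.div_add_mod m (p ^ 2)]
        ring
      refine ⟨(i + (m / p ^ 2) * q ^ 2, m % p ^ 2), ⟨?_, Nat.mod_lt _ hpp⟩, e⟩
      rw [mem_B]
      simp only [e]
      exact hk
  rw [← c1]
  obtain ⟨hf, hc⟩ := hB l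
  have hdis := Set.ncard_inter_add_ncard_sdiff_eq_ncard (B p q l) {x | x.2 < p ^ 2} hf
  rw [hc] at hdis
  have c2 : (B p q l \ {x | x.2 < p ^ 2}).ncard = l + 1 - p * q := by
    by_cases hl : p * q ≤ l
    · obtain ⟨t, rfl⟩ := Nat.exists_eq_add_of_le hl
      have : (B p q t).ncard = (B p q (p * q + t : ℕ) \ {x | x.2 < p ^ 2}).ncard := by
        refine Set.ncard_congr (fun x _ => (x.1, x.2 + p ^ 2)) ?_ ?_ ?_
        · rintro ⟨i, m⟩ hx
          rw [mem_B] at hx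
          refine ⟨?_, by simp⟩
          rw [mem_B]
          push_cast at hx ⊢
          constructor <;> nlinarith
        · rintro ⟨i, m⟩ ⟨i', m'⟩ _ _ e
          simpa using e
        · rintro ⟨i, m⟩ ⟨hx, hm⟩
          simp only [Set.mem_ofPred_eq, not_lt] at hm
          obtain ⟨s, rfl⟩ := Nat.exists_eq_add_of_le hm
          refine ⟨(i, s), ?_, by simp [add_comm]⟩
          rw [mem_B] at hx ⊢
          push_cast at hx ⊢
          constructor <;> nlinarith
      rw [← this, (hB t).2]; omega
    · have : B p q l \ {x | x.2 < p ^ 2} = ∅ := by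
        rw [Set.eq_empty_iff_forall_notMem]
        rintro ⟨i, m⟩ ⟨hx, hm⟩
        simp only [Set.mem_ofPred_eq, not_lt] at hm
        rw [mem_B] at hx
        have h2 : i * p ^ 2 + m * q ^ 2 ≤ l * (p * q) := by exact_mod_cast hx.2
        have h3 : p ^ 2 * q ^ 2 ≤ m * q ^ 2 := Nat.mul_le_mul_right _ hm
        have h4 : l * (p * q) < (p * q) * (p * q) :=
          Nat.mul_lt_mul_of_pos_right (by omega) (by positivity)
        have h5 : p ^ 2 * q ^ 2 = (p * q) * (p * q) := by ring
        have := Nat.zero_le (i * p ^ 2)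
        omega
      rw [this, Set.ncard_empty]; omega
  rw [c2] at hdis
  have := Nat.mul_pos hp hq
  omega

end FibStrip


/-- For odd `j ≥ 5`, `a = φ_{j−2}²`, `b = φ_j²`, `d = φ_{j−2}·φ_j` and `Γ = ⟨a,b⟩`: for
every `l ≥ 0` the number of elements of `Γ` in `((l−1)d, ld]` equals `min(l+1, d)`. -/
theorem distribution_case_c (j : ℕ) (hj : 5 ≤ j) (hodd : Odd j) (l : ℕ) :
    Nat.card {k : ℕ // (∃ i m : ℕ, k = i * Nat.fib (j - 2) ^ 2 + m * Nat.fib j ^ 2) ∧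
      ((l : ℤ) - 1) * (Nat.fib (j - 2) * Nat.fib j) < (k : ℤ) ∧
        (k : ℤ) ≤ (l : ℤ) * (Nat.fib (j - 2) * Nat.fib j)} =
      min (l + 1) (Nat.fib (j - 2) * Nat.fib j) := by
  obtain ⟨n, hn⟩ := hodd
  obtain ⟨k, rfl⟩ : ∃ k, j = 2 * k + 3 := ⟨n - 1, by omega⟩
  have hm := FibStrip.main (Nat.fib (2 * k + 1)) (Nat.fib (2 * k + 3))
    (Nat.fib_pos.mpr (by omega)) (Nat.fib_pos.mpr (by omega))
    (FibStrip.fib_markov k) (FibStrip.fib_T_card k) l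
  exact hm
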